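/- arXiv:2107.12784 — 3 statements merged into one kernel-verified Lean document; each statement's English description precedes it below -/
import Mathlib

section
/- Let n ≥ 1, let Ω ⊂ ℝⁿ be open, let u : ℝⁿ → ℝ be three times continuously differentiable on Ω, and let δ > 0. Define φ_δ(x) = (‖∇u(x)‖² + δ)^{1/2}. Then at every point x ∈ Ω with ∇u(x) ≠ 0, setting ν = ∇u(x)/‖∇u(x)‖, one has Δφ_δ(x) ≥ (1/φ_δ(x)) ( ‖∇²u(x)‖_F² − ‖∇²u(x)(ν)‖² + ⟨∇u(x), ∇(Δu)(x)⟩ ), where ∇²u(x)(ν) ∈ ℝⁿ is the Hessian operator applied to ν, i.e. the vector with components ∑ⱼ ∂ᵢ∂ⱼu(x) νⱼ. -/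
open scoped RealInnerProductSpace

noncomputable section

/-- Standard orthonormal basis vector of Euclidean space. -/
def stdE (n : ℕ) (i : Fin n) : EuclideanSpace ℝ (Fin n) := EuclideanSpace.single i 1

/-- The Laplacian `Δu(x) = ∑ i, ∂ᵢ∂ᵢ u (x)`. -/
def lap {n : ℕ} (u : EuclideanSpace ℝ (Fin n) → ℝ) (x : EuclideanSpace ℝ (Fin n)) : ℝ :=
  ∑ i, fderiv ℝ (fun y => fderiv ℝ u y (stdE n i)) x (stdE n i)

/-- The Hessian bilinear form `∇²u(x)(v,w)`. -/
def hessB {n : ℕ} (u : EuclideanSpace ℝ (Fin n) → ℝ) (x v w : EuclideanSpace ℝ (Fin n)) : ℝ :=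
  fderiv ℝ (fun y => fderiv ℝ u y w) x v

/-- The Hessian operator `∇²u(x)` applied to a vector `v`, i.e. the vector with
components `∑ⱼ ∂ᵢ∂ⱼ u(x) vⱼ`. -/
def hessV {n : ℕ} (u : EuclideanSpace ℝ (Fin n) → ℝ) (x v : EuclideanSpace ℝ (Fin n)) :
    EuclideanSpace ℝ (Fin n) :=
  gradient (fun y => fderiv ℝ u y v) x

/-- The squared Frobenius norm of the Hessian, `∑ᵢⱼ (∂ᵢ∂ⱼ u(x))²`. -/
def hessFrob2 {n : ℕ} (u : EuclideanSpace ℝ (Fin n) → ℝ) (x : EuclideanSpace ℝ (Fin n)) : ℝ :=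
  ∑ i, ∑ j, (hessB u x (stdE n i) (stdE n j)) ^ 2

/-- The divergence `div F(x) = ∑ i, ∂ᵢ Fᵢ (x)` of a vector field. -/
def divg {n : ℕ} (F : EuclideanSpace ℝ (Fin n) → EuclideanSpace ℝ (Fin n))
    (x : EuclideanSpace ℝ (Fin n)) : ℝ :=
  ∑ i, fderiv ℝ (fun y => ⟪F y, stdE n i⟫) x (stdE n i)
/-- A linear functional on `ℝⁿ` is the sum of its values on the standard basis, weighted by the
coordinates. -/
theorem clm_apply_eq_sum_stdE {n : ℕ} (L : EuclideanSpace ℝ (Fin n) →L[ℝ] ℝ)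
    (v : EuclideanSpace ℝ (Fin n)) : L v = ∑ j, v j * L (stdE n j) := by
  conv_lhs => rw [← (EuclideanSpace.basisFun (Fin n) ℝ).sum_repr v]
  simp [map_sum, stdE]

theorem gradient_apply_eq_fderiv_stdE {n : ℕ} (f : EuclideanSpace ℝ (Fin n) → ℝ)
    (x : EuclideanSpace ℝ (Fin n)) (i : Fin n) :
    gradient f x i = fderiv ℝ f x (stdE n i) := by
  have h : ⟪gradient f x, stdE n i⟫ = fderiv ℝ f x (stdE n i) := by
    rw [gradient, InnerProductSpace.toDual_symm_apply]
  rw [← h, stdE, EuclideanSpace.inner_single_right]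
  simp

theorem inner_gradient_gradient_eq_sum {n : ℕ} (f g : EuclideanSpace ℝ (Fin n) → ℝ)
    (x : EuclideanSpace ℝ (Fin n)) :
    ⟪gradient f x, gradient g x⟫ =
      ∑ j, fderiv ℝ f x (stdE n j) * fderiv ℝ g x (stdE n j) := by
  simp only [PiLp.inner_apply, gradient_apply_eq_fderiv_stdE]
  exact Finset.sum_congr rfl fun j _ => by simp [mul_comm]

theorem norm_gradient_sq_eq_sum {n : ℕ} (f : EuclideanSpace ℝ (Fin n) → ℝ)
    (x : EuclideanSpace ℝ (Fin n)) :
    ‖gradient f x‖ ^ 2 = ∑ j, fderiv ℝ f x (stdE n j) ^ 2 := by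
  simp [EuclideanSpace.real_norm_sq_eq, gradient_apply_eq_fderiv_stdE]

theorem ContDiffAt.fderiv_apply_const {E : Type*} [NormedAddCommGroup E] [NormedSpace ℝ E]
    {f : E → ℝ} {x : E} {m k : WithTop ℕ∞} (hf : ContDiffAt ℝ k f x) (hk : m + 1 ≤ k) (v : E) :
    ContDiffAt ℝ m (fun y => fderiv ℝ f y v) x :=
  (hf.fderiv_right hk).clm_apply contDiffAt_const

theorem fderiv_fderiv_apply_comm {E : Type*} [NormedAddCommGroup E] [NormedSpace ℝ E]
    {f : E → ℝ} {x : E} (hf : ContDiffAt ℝ 2 f x) (v w : E) :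
    fderiv ℝ (fun y => fderiv ℝ f y v) x w = fderiv ℝ (fun y => fderiv ℝ f y w) x v := by
  have hd : DifferentiableAt ℝ (fderiv ℝ f) x :=
    (hf.fderiv_right (m := 1) (by norm_num)).differentiableAt (by norm_num)
  have key : ∀ a b : E, fderiv ℝ (fun y => fderiv ℝ f y a) x b =
      fderiv ℝ (fderiv ℝ f) x b a := fun a b => by
    rw [fderiv_clm_apply hd (differentiableAt_const a)]
    simp
  rw [key, key]
  exact (hf.isSymmSndFDerivAt (by simp)) w v

theorem norm_hessV_sq_eq_sum {n : ℕ} {u : EuclideanSpace ℝ (Fin n) → ℝ}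
    {x : EuclideanSpace ℝ (Fin n)} (hu : ContDiffAt ℝ 2 u x) (v : EuclideanSpace ℝ (Fin n)) :
    ‖hessV u x v‖ ^ 2 = ∑ i, (∑ j, v j * hessB u x (stdE n i) (stdE n j)) ^ 2 := by
  rw [hessV, norm_gradient_sq_eq_sum]
  refine Finset.sum_congr rfl fun i _ => ?_
  rw [fderiv_fderiv_apply_comm hu, clm_apply_eq_sum_stdE]
  simp only [hessB, fderiv_fderiv_apply_comm hu (stdE n i)]

theorem inner_gradient_gradient_lap {n : ℕ} {u : EuclideanSpace ℝ (Fin n) → ℝ}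
    {x : EuclideanSpace ℝ (Fin n)} (hu : ContDiffAt ℝ 3 u x) :
    ⟪gradient u x, gradient (fun y => lap u y) x⟫ =
      ∑ i, ∑ j, fderiv ℝ u x (stdE n j) *
        fderiv ℝ (fun y => hessB u y (stdE n i) (stdE n j)) x (stdE n i) := by
  have hg : ∀ i, ContDiffAt ℝ 2 (fun y => fderiv ℝ u y (stdE n i)) x := fun i =>
    hu.fderiv_apply_const (by norm_num) _
  have hdd : ∀ i, DifferentiableAt ℝ
      (fun y => fderiv ℝ (fun z => fderiv ℝ u z (stdE n i)) y (stdE n i)) x := fun i =>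
    ((hg i).fderiv_apply_const (m := 1) (by norm_num) _).differentiableAt (by norm_num)
  rw [inner_gradient_gradient_eq_sum, Finset.sum_comm]
  refine Finset.sum_congr rfl fun j _ => ?_
  rw [← Finset.mul_sum]
  congr 1
  simp only [lap]
  rw [fderiv_fun_sum fun i _ => hdd i, sum_apply]
  refine Finset.sum_congr rfl fun i _ => ?_
  rw [fderiv_fderiv_apply_comm (hg i)]
  have h2 : ∀ᶠ y in nhds x, ContDiffAt ℝ 2 u y :=
    (hu.of_le (by norm_num)).eventually (by simp)
  have : (fun y => fderiv ℝ (fun z => fderiv ℝ u z (stdE n i)) y (stdE n j)) =ᶠ[nhds x]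
      fun y => hessB u y (stdE n i) (stdE n j) :=
    h2.mono fun y hy => fderiv_fderiv_apply_comm hy _ _
  rw [this.fderiv_eq]

theorem hasFDerivAt_sqrt_norm_gradient_sq_add {n : ℕ} {u : EuclideanSpace ℝ (Fin n) → ℝ}
    {x : EuclideanSpace ℝ (Fin n)} (hu : ContDiffAt ℝ 2 u x) {δ : ℝ} (hδ : 0 < δ) :
    HasFDerivAt (fun y => √(‖gradient u y‖ ^ 2 + δ))
      ((√(‖gradient u x‖ ^ 2 + δ))⁻¹ • ∑ j, fderiv ℝ u x (stdE n j) •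
        fderiv ℝ (fun y => fderiv ℝ u y (stdE n j)) x) x := by
  have hg : ∀ j, HasFDerivAt (fun y => fderiv ℝ u y (stdE n j))
      (fderiv ℝ (fun y => fderiv ℝ u y (stdE n j)) x) x := fun j =>
    ((hu.fderiv_apply_const (m := 1) (by norm_num) _).differentiableAt
      (by norm_num)).hasFDerivAt
  have hP : HasFDerivAt (fun y => ‖gradient u y‖ ^ 2 + δ)
      (∑ j, (2 * fderiv ℝ u x (stdE n j)) •
        fderiv ℝ (fun y => fderiv ℝ u y (stdE n j)) x) x := by
    simp only [norm_gradient_sq_eq_sum]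
    refine (HasFDerivAt.fun_sum fun j _ => ?_).add_const δ
    simpa using (hg j).pow 2
  refine (hP.sqrt (by positivity)).congr_fderiv ?_
  simp only [Finset.smul_sum, smul_smul]
  refine Finset.sum_congr rfl fun j _ => ?_
  congr 1
  field_simp

/-- The Bochner-type identity for the Laplacian of `(‖∇u‖² + δ)^{1/2}`. -/
theorem lap_sqrt_norm_gradient_sq_add {n : ℕ} {u : EuclideanSpace ℝ (Fin n) → ℝ}
    {x : EuclideanSpace ℝ (Fin n)} (hu : ContDiffAt ℝ 3 u x) {δ : ℝ} (hδ : 0 < δ) :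
    lap (fun y => √(‖gradient u y‖ ^ 2 + δ)) x =
      (√(‖gradient u x‖ ^ 2 + δ))⁻¹ *
        (hessFrob2 u x + ⟪gradient u x, gradient (fun y => lap u y) x⟫
          - ‖hessV u x (gradient u x)‖ ^ 2 / (‖gradient u x‖ ^ 2 + δ)) := by
  have hu2 : ContDiffAt ℝ 2 u x := hu.of_le (by norm_num)
  have hg : ∀ j, ContDiffAt ℝ 2 (fun y => fderiv ℝ u y (stdE n j)) x := fun j =>
    hu.fderiv_apply_const (by norm_num) _
  have hgd : ∀ j, HasFDerivAt (fun y => fderiv ℝ u y (stdE n j))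
      (fderiv ℝ (fun y => fderiv ℝ u y (stdE n j)) x) x := fun j =>
    ((hg j).differentiableAt (by norm_num)).hasFDerivAt
  have hH : ∀ i j, HasFDerivAt (fun y => hessB u y (stdE n i) (stdE n j))
      (fderiv ℝ (fun y => hessB u y (stdE n i) (stdE n j)) x) x := fun i j =>
    (((hg j).fderiv_apply_const (m := 1) (by norm_num) _).differentiableAt
      (by norm_num)).hasFDerivAt
  have hev : ∀ᶠ y in nhds x, ContDiffAt ℝ 2 u y := hu2.eventually (by simp)
  have hpos : 0 < ‖gradient u x‖ ^ 2 + δ := by positivity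
  have hterm : ∀ i, fderiv ℝ (fun y => fderiv ℝ (fun z => √(‖gradient u z‖ ^ 2 + δ)) y
        (stdE n i)) x (stdE n i) =
      (√(‖gradient u x‖ ^ 2 + δ))⁻¹ *
        (∑ j, hessB u x (stdE n i) (stdE n j) ^ 2
          + ∑ j, fderiv ℝ u x (stdE n j) *
              fderiv ℝ (fun y => hessB u y (stdE n i) (stdE n j)) x (stdE n i)
          - (∑ j, fderiv ℝ u x (stdE n j) * hessB u x (stdE n i) (stdE n j)) ^ 2
            / (‖gradient u x‖ ^ 2 + δ)) := by
    intro i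
    have hfirst : (fun y => fderiv ℝ (fun z => √(‖gradient u z‖ ^ 2 + δ)) y (stdE n i))
        =ᶠ[nhds x] fun y => (√(‖gradient u y‖ ^ 2 + δ))⁻¹ *
          ∑ j, fderiv ℝ u y (stdE n j) * hessB u y (stdE n i) (stdE n j) := by
      filter_upwards [hev] with y hy
      rw [(hasFDerivAt_sqrt_norm_gradient_sq_add hy hδ).fderiv]
      simp [hessB]
    have hinv := (hasDerivAt_inv (Real.sqrt_pos.2 hpos).ne').comp_hasFDerivAt x
      (hasFDerivAt_sqrt_norm_gradient_sq_add hu2 hδ)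
    have hsum := HasFDerivAt.fun_sum (u := Finset.univ) fun j _ => (hgd j).mul (hH i j)
    have hprod := hinv.mul hsum
    rw [hfirst.fderiv_eq]
    refine (congrArg (fun L => L (stdE n i)) hprod.fderiv).trans ?_
    have hs : √(‖gradient u x‖ ^ 2 + δ) ^ 2 = ‖gradient u x‖ ^ 2 + δ := Real.sq_sqrt hpos.le
    have hs0 := (Real.sqrt_pos.2 hpos).ne'
    rw [← hs]
    simp only [Real.sqrt_sq (Real.sqrt_nonneg _)]
    simp only [hessB, Function.comp_apply, Pi.mul_apply, add_apply,
      smul_apply, sum_apply, smul_eq_mul,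
      Finset.sum_add_distrib, pow_two]
    field_simp
    ring
  have hfrob : hessFrob2 u x = ∑ i, ∑ j, hessB u x (stdE n i) (stdE n j) ^ 2 := rfl
  rw [lap, Finset.sum_congr rfl fun i _ => hterm i, ← Finset.mul_sum, hfrob,
    inner_gradient_gradient_lap hu, norm_hessV_sq_eq_sum hu2]
  simp only [gradient_apply_eq_fderiv_stdE, Finset.sum_div, Finset.sum_add_distrib,
    Finset.sum_sub_distrib]

/-- For `u` three times continuously differentiable on an open `Ω ⊆ ℝⁿ` and
`δ > 0`, at every noncritical point `x ∈ Ω` with unit normal `ν = ∇u(x)/‖∇u(x)‖`, the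
regularized gradient `φ_δ = (‖∇u‖² + δ)^{1/2}` satisfies
`Δφ_δ(x) ≥ (1/φ_δ(x)) (‖∇²u(x)‖_F² − ‖∇²u(x)(ν)‖² + ⟨∇u(x), ∇(Δu)(x)⟩)`. -/
theorem laplacian_regularized_gradient_lower_bound {n : ℕ} (hn : 1 ≤ n)
    {Ω : Set (EuclideanSpace ℝ (Fin n))} (hΩ : IsOpen Ω)
    {u : EuclideanSpace ℝ (Fin n) → ℝ} (hu : ContDiffOn ℝ 3 u Ω)
    {δ : ℝ} (hδ : 0 < δ)
    (φ : EuclideanSpace ℝ (Fin n) → ℝ)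
    (hφ : ∀ y, φ y = Real.sqrt (‖gradient u y‖ ^ 2 + δ)) :
    ∀ x ∈ Ω, gradient u x ≠ 0 →
      lap φ x ≥
        (1 / φ x) *
          (hessFrob2 u x - ‖hessV u x (‖gradient u x‖⁻¹ • gradient u x)‖ ^ 2
            + ⟪gradient u x, gradient (fun y => lap u y) x⟫) := by
  intro x hx hgrad
  have hux : ContDiffAt ℝ 3 u x := hu.contDiffAt (hΩ.mem_nhds hx)
  have hnorm : 0 < ‖gradient u x‖ ^ 2 := by positivity
  have hlin : ‖hessV u x (‖gradient u x‖⁻¹ • gradient u x)‖ ^ 2 =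
      ‖hessV u x (gradient u x)‖ ^ 2 / ‖gradient u x‖ ^ 2 := by
    have hu2 : ContDiffAt ℝ 2 u x := hux.of_le (by norm_num)
    rw [norm_hessV_sq_eq_sum hu2, norm_hessV_sq_eq_sum hu2, Finset.sum_div]
    refine Finset.sum_congr rfl fun i _ => ?_
    simp only [PiLp.smul_apply, smul_eq_mul, mul_assoc, ← Finset.mul_sum]
    rw [mul_pow, inv_pow, div_eq_inv_mul]
  rw [funext hφ, lap_sqrt_norm_gradient_sq_add hux hδ, hlin, one_div, ge_iff_le]
  have hle : ‖hessV u x (gradient u x)‖ ^ 2 / (‖gradient u x‖ ^ 2 + δ) ≤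
      ‖hessV u x (gradient u x)‖ ^ 2 / ‖gradient u x‖ ^ 2 :=
    div_le_div_of_nonneg_left (by positivity) hnorm (by linarith)
  exact mul_le_mul_of_nonneg_left (by linarith) (by positivity)
end
end

section
/- Let Ω ⊂ ℝⁿ be open, let u : ℝⁿ → ℝ be twice continuously differentiable on Ω, let x ∈ Ω with ∇u(x) ≠ 0, and suppose ∇u(y) ≠ 0 for all y in a neighborhood of x contained in Ω. Let p be a symmetric bilinear form on ℝⁿ, let h, P̃ ∈ ℝ, and suppose Δu(x) = (h − tr p) ‖∇u(x)‖. Set ν = ∇u(x)/‖∇u(x)‖, H_S = div(∇u/‖∇u‖)(x), and tr_S p = tr p − p(ν, ν). Then ⟨ν, ∇(‖∇u‖)(x)⟩ + p(∇u(x), ν) = ( −H_S − tr_S p + h ) ‖∇u(x)‖. -/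
open scoped RealInnerProductSpace

noncomputable section

theorem inner_gradient_right_apply {E : Type*} [NormedAddCommGroup E] [InnerProductSpace ℝ E]
    [CompleteSpace E] (f : E → ℝ) (x v : E) : ⟪v, gradient f x⟫ = fderiv ℝ f x v := by
  rw [real_inner_comm, gradient, InnerProductSpace.toDual_symm_apply]

/-- The gradient of a function that is `C²` at `x` is differentiable at `x`. -/
theorem ContDiffAt.differentiableAt_gradient {E : Type*} [NormedAddCommGroup E]
    [InnerProductSpace ℝ E] [CompleteSpace E] {f : E → ℝ} {x : E} (hf : ContDiffAt ℝ 2 f x) :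
    DifferentiableAt ℝ (gradient f) x :=
  (InnerProductSpace.toDual ℝ E).symm.differentiableAt.comp x
    ((hf.fderiv_right (m := 1) (by norm_num)).differentiableAt (by norm_num))

theorem sum_inner_stdE_smul {n : ℕ} (v : EuclideanSpace ℝ (Fin n)) :
    ∑ i, ⟪v, stdE n i⟫ • stdE n i = v := by
  simpa [stdE, real_inner_comm] using (EuclideanSpace.basisFun (Fin n) ℝ).sum_repr' v

theorem divg_gradient {n : ℕ} (u : EuclideanSpace ℝ (Fin n) → ℝ)
    (x : EuclideanSpace ℝ (Fin n)) : divg (gradient u) x = lap u x := by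
  simp only [divg, lap, real_inner_comm (stdE n _), inner_gradient_right_apply]

/-- The product rule `div (f F) = f div F + Df(F)`. -/
theorem divg_smul {n : ℕ} {f : EuclideanSpace ℝ (Fin n) → ℝ}
    {F : EuclideanSpace ℝ (Fin n) → EuclideanSpace ℝ (Fin n)} {x : EuclideanSpace ℝ (Fin n)}
    (hf : DifferentiableAt ℝ f x) (hF : DifferentiableAt ℝ F x) :
    divg (fun y => f y • F y) x = f x * divg F x + fderiv ℝ f x (F x) := by
  have hterm (i : Fin n) : fderiv ℝ (fun y => ⟪f y • F y, stdE n i⟫) x (stdE n i) =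
      f x * fderiv ℝ (fun y => ⟪F y, stdE n i⟫) x (stdE n i) +
        ⟪F x, stdE n i⟫ * fderiv ℝ f x (stdE n i) := by
    have hi : DifferentiableAt ℝ (fun y => ⟪F y, stdE n i⟫) x :=
      hF.inner ℝ (differentiableAt_const _)
    simp only [real_inner_smul_left]
    rw [fderiv_fun_mul hf hi]
    simp
  simp only [divg, hterm, Finset.sum_add_distrib, ← Finset.mul_sum]
  congr 1
  conv_rhs => rw [← sum_inner_stdE_smul (F x), map_sum]
  simp only [map_smul, smul_eq_mul]

/-- Euclidean pointwise Dirichlet boundary lemma. Let `u` be `C²` on an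
open `Ω ⊆ ℝⁿ`, with `∇u ≠ 0` on a neighborhood of `x` contained in `Ω`, let `p` be a
symmetric bilinear form, `h, P̃ ∈ ℝ`, and suppose `Δu(x) = (h − tr p)‖∇u(x)‖`. With
`ν = ∇u(x)/‖∇u(x)‖`, `H_S = div(∇u/‖∇u‖)(x)` and `tr_S p = tr p − p(ν,ν)`, one has
`⟨ν, ∇‖∇u‖(x)⟩ + p(∇u(x), ν) = (−H_S − tr_S p + h)‖∇u(x)‖`. -/
theorem dirichlet_boundary_lemma {n : ℕ} (hn : 1 ≤ n)
    {Ω : Set (EuclideanSpace ℝ (Fin n))} (hΩ : IsOpen Ω)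
    {u : EuclideanSpace ℝ (Fin n) → ℝ} (hu : ContDiffOn ℝ 2 u Ω)
    {x : EuclideanSpace ℝ (Fin n)} (hx : x ∈ Ω) (h0 : gradient u x ≠ 0)
    (hnb : ∃ V : Set (EuclideanSpace ℝ (Fin n)),
      IsOpen V ∧ x ∈ V ∧ V ⊆ Ω ∧ ∀ y ∈ V, gradient u y ≠ 0)
    (p : EuclideanSpace ℝ (Fin n) →ₗ[ℝ] EuclideanSpace ℝ (Fin n) →ₗ[ℝ] ℝ)
    (hpsymm : ∀ v w, p v w = p w v)
    (h P' : ℝ)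
    (trp : ℝ) (htrp : trp = ∑ i, p (stdE n i) (stdE n i))
    (hlap : lap u x = (h - trp) * ‖gradient u x‖)
    (ν : EuclideanSpace ℝ (Fin n)) (hν : ν = ‖gradient u x‖⁻¹ • gradient u x)
    (HS : ℝ) (hHS : HS = divg (fun y => ‖gradient u y‖⁻¹ • gradient u y) x)
    (trS : ℝ) (htrS : trS = trp - p ν ν) :
    ⟪ν, gradient (fun y => ‖gradient u y‖) x⟫ + p (gradient u x) ν =
      (-HS - trS + h) * ‖gradient u x‖ := by
  have hg : DifferentiableAt ℝ (gradient u) x :=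
    (hu.contDiffAt (hΩ.mem_nhds hx)).differentiableAt_gradient
  have hN : DifferentiableAt ℝ (fun y => ‖gradient u y‖) x := hg.norm ℝ h0
  have hN0 : ‖gradient u x‖ ≠ 0 := norm_ne_zero_iff.mpr h0
  have hinv : HasFDerivAt (fun y => ‖gradient u y‖⁻¹)
      (-(‖gradient u x‖ ^ 2)⁻¹ • fderiv ℝ (fun y => ‖gradient u y‖) x) x :=
    (hasDerivAt_inv hN0).comp_hasFDerivAt x hN.hasFDerivAt
  rw [divg_smul hinv.differentiableAt hg, divg_gradient, hlap, hinv.fderiv,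
    smul_apply, smul_eq_mul] at hHS
  have hdir : ⟪ν, gradient (fun y => ‖gradient u y‖) x⟫ =
      ‖gradient u x‖⁻¹ * fderiv ℝ (fun y => ‖gradient u y‖) x (gradient u x) := by
    rw [inner_gradient_right_apply, hν, map_smul, smul_eq_mul]
  rw [hdir, htrS, hHS, hν]
  simp only [map_smul, LinearMap.smul_apply, smul_eq_mul]
  field_simp
  ring
end
end

section
/- Let Ω ⊂ ℝⁿ be open, let f, u : ℝⁿ → ℝ be twice continuously differentiable on Ω, let x ∈ Ω, set c = f(x), and let S = { y ∈ Ω : f(y) = c }. Suppose ∇f(y) ≠ 0 for all y ∈ S, and let η(y) = ∇f(y)/‖∇f(y)‖ (defined and C¹ near S). Suppose the Neumann condition ⟨∇u(y), η(y)⟩ = 0 holds for all y ∈ S. If ∇u(x) ≠ 0, then ⟨η(x), ∇(‖∇u‖)(x)⟩ = − (1/‖∇u(x)‖) ⟨ (Dη(x))(∇u(x)), ∇u(x) ⟩, where Dη(x) is the Fréchet derivative of the vector field η at x. -/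
open scoped RealInnerProductSpace

noncomputable section

open scoped Gradient Topology
open InnerProductSpace

section Gradient

variable {E : Type*} [NormedAddCommGroup E] [InnerProductSpace ℝ E] [CompleteSpace E]

theorem ContDiffAt.gradient_one {u : E → ℝ} {x : E} (hu : ContDiffAt ℝ 2 u x) :
    ContDiffAt ℝ 1 (∇ u) x :=
  (toDual ℝ E).symm.contDiff.contDiffAt.comp x (hu.fderiv_right (m := 1) (by norm_num))

/-- The derivative of the gradient of a `C²` function is a symmetric operator. -/
theorem ContDiffAt.inner_fderiv_gradient_comm {u : E → ℝ} {x : E} (hu : ContDiffAt ℝ 2 u x)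
    (v w : E) : ⟪fderiv ℝ (∇ u) x v, w⟫ = ⟪fderiv ℝ (∇ u) x w, v⟫ := by
  have hd : DifferentiableAt ℝ (fderiv ℝ u) x :=
    (hu.fderiv_right (m := 1) (by norm_num)).differentiableAt one_ne_zero
  have key (a b : E) : ⟪fderiv ℝ (∇ u) x a, b⟫ = fderiv ℝ (fderiv ℝ u) x a b := by
    have h : (fun y => ⟪∇ u y, b⟫) = fun y => fderiv ℝ u y b :=
      funext fun _ => inner_gradient_left
    have h' := congrArg (fun g => fderiv ℝ g x a) h
    rw [fderiv_inner_apply ℝ (hu.gradient_one.differentiableAt one_ne_zero)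
      (differentiableAt_const b), fderiv_clm_apply hd (differentiableAt_const b)] at h'
    simpa using h'
  rw [key, key]
  exact hu.isSymmSndFDerivAt (by simp) v w

theorem inner_gradient_norm {F : E → E} {x : E} (hF : DifferentiableAt ℝ F x) (h0 : F x ≠ 0)
    (w : E) : ⟪w, ∇ (fun y => ‖F y‖) x⟫ = ‖F x‖⁻¹ * ⟪fderiv ℝ F x w, F x⟫ := by
  have hd : DifferentiableAt ℝ (fun y => ‖F y‖) x := hF.norm ℝ h0
  have h1 := (hd.hasFDerivAt.pow 2).unique hF.hasFDerivAt.norm_sq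
  have h2 := congrArg (fun L : E →L[ℝ] ℝ => L w) h1
  rw [real_inner_comm, inner_gradient_left, real_inner_comm]
  simp at h2
  have : ‖F x‖ ≠ 0 := norm_ne_zero_iff.2 h0
  field_simp
  linarith

/-- A function vanishing on a regular level set of `f` has vanishing derivative along it. -/
theorem HasStrictFDerivAt.apply_eq_zero_of_eqOn_levelSet {f g : E → ℝ} {f' g' : StrongDual ℝ E}
    {x v : E} (hf : HasStrictFDerivAt f f' x) (hg : HasStrictFDerivAt g g' x) (hf' : f' ≠ 0)
    (h : ∀ᶠ y in 𝓝 x, f y = f x → g y = 0) (hv : f' v = 0) : g' v = 0 := by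
  have hext : IsLocalExtrOn g {y | f y = f x} x := by
    refine Or.inl (eventually_nhdsWithin_iff.2 (h.mono fun y hy hyx => ?_))
    rw [hy hyx, h.self_of_nhds rfl]
  obtain ⟨a, b, hab, h⟩ := hext.exists_multipliers_of_hasStrictFDerivAt_1d hf hg
  have hb : b ≠ 0 := by
    rintro rfl
    have ha : a ≠ 0 := by simpa using hab
    exact hf' (by simpa [ha] using h)
  simpa [hv, hb] using congrArg (fun L : StrongDual ℝ E => L v) h

end Gradient

/-- Euclidean Neumann boundary lemma. Let `f, u` be `C²` on an open
`Ω ⊆ ℝⁿ`, `x ∈ Ω`, `c = f(x)`, `S = {y ∈ Ω | f(y) = c}` a regular level set of `f` with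
unit normal `η = ∇f/‖∇f‖`. If the Neumann condition `⟨∇u, η⟩ = 0` holds on `S` and
`∇u(x) ≠ 0`, then `⟨η(x), ∇‖∇u‖(x)⟩ = −(1/‖∇u(x)‖)⟨Dη(x)(∇u(x)), ∇u(x)⟩`. -/
theorem neumann_boundary_lemma {n : ℕ} (hn : 1 ≤ n)
    {Ω : Set (EuclideanSpace ℝ (Fin n))} (hΩ : IsOpen Ω)
    {f u : EuclideanSpace ℝ (Fin n) → ℝ}
    (hf : ContDiffOn ℝ 2 f Ω) (hu : ContDiffOn ℝ 2 u Ω)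
    {x : EuclideanSpace ℝ (Fin n)} (hx : x ∈ Ω)
    (c : ℝ) (hc : c = f x)
    (S : Set (EuclideanSpace ℝ (Fin n))) (hS : S = {y ∈ Ω | f y = c})
    (hreg : ∀ y ∈ S, gradient f y ≠ 0)
    (η : EuclideanSpace ℝ (Fin n) → EuclideanSpace ℝ (Fin n))
    (hη : ∀ y, η y = ‖gradient f y‖⁻¹ • gradient f y)
    (hNeu : ∀ y ∈ S, ⟪gradient u y, η y⟫ = 0)
    (h0 : gradient u x ≠ 0) :
    ⟪η x, gradient (fun y => ‖gradient u y‖) x⟫ =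
      -(1 / ‖gradient u x‖) * ⟪fderiv ℝ η x (gradient u x), gradient u x⟫ := by
  subst hc hS
  obtain rfl : η = fun y => ‖∇ f y‖⁻¹ • ∇ f y := funext hη
  have hΩx : Ω ∈ 𝓝 x := hΩ.mem_nhds hx
  have hfx := hf.contDiffAt hΩx
  have hux := hu.contDiffAt hΩx
  have hfx0 : ∇ f x ≠ 0 := hreg x ⟨hx, rfl⟩
  have hηx : ContDiffAt ℝ 1 (fun y => ‖∇ f y‖⁻¹ • ∇ f y) x :=
    ((hfx.gradient_one.norm ℝ hfx0).inv (norm_ne_zero_iff.2 hfx0)).smul hfx.gradient_one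
  set η := fun y => ‖∇ f y‖⁻¹ • ∇ f y
  have hdu := hux.gradient_one.differentiableAt one_ne_zero
  have hdη := hηx.differentiableAt one_ne_zero
  have htan : fderiv ℝ f x (∇ u x) = 0 := by
    have h := hNeu x ⟨hx, rfl⟩
    rw [real_inner_smul_right] at h
    rw [← inner_gradient_left, real_inner_comm]
    exact (mul_eq_zero.1 h).resolve_left (inv_ne_zero (norm_ne_zero_iff.2 hfx0))
  have hf' : fderiv ℝ f x ≠ 0 := fun h => hfx0 (by simp [gradient, h])
  have hg : HasStrictFDerivAt (fun y => ⟪∇ u y, η y⟫) _ x :=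
    (hux.gradient_one.inner ℝ hηx).hasStrictFDerivAt one_ne_zero
  have hzero := (hfx.hasStrictFDerivAt two_ne_zero).apply_eq_zero_of_eqOn_levelSet hg hf'
    (Filter.eventually_of_mem hΩx fun y hy hyx => hNeu y ⟨hy, hyx⟩) htan
  rw [fderiv_inner_apply ℝ hdu hdη, hux.inner_fderiv_gradient_comm,
    real_inner_comm (fderiv ℝ η x _)] at hzero
  rw [inner_gradient_norm hdu h0, one_div, neg_mul, ← mul_neg]
  congr 1
  linarith
end
end
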